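/- Let G be a labeled weighted graph and Q a rooted query tree with label constraint ψ. Let B be a finite nonempty set of partial matches, each having at least one complete homomorphic match as a successor, and let P ∈ B be a non-complete partial match with priority(P) ≤ priority(X) for every X ∈ B. Then P has a direct successor P', having at least one complete homomorphic match as a successor, such that priority(P') ≤ priority(X) for every X ∈ B. (Soundness of the front-element optimization: if the last pop returned an incomplete pattern, one of its direct successors has priority equal to the minimum priority over all queue elements.) -/

import Mathlib

open Finset
open scoped Classical

noncomputable section

/-- A finite rooted tree on node type `A`, given by its root and parent function. -/
structure QueryTree (A : Type) where
  root : A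
  parent : A → A
  parent_root : parent root = root
  reaches : ∀ v : A, ∃ n : ℕ, parent^[n] v = root

variable {V L A : Type}

/-- A (complete) homomorphic match of the query tree `Q` (with label constraint `ψ`)
in the labeled graph `G` (with node labeling `φ`). -/
def IsMatch [Fintype A] [DecidableEq A] (G : SimpleGraph V) (φ : V → L)
    (Q : QueryTree A) (ψ : A → L) (lam : A → V) : Prop :=
  (∀ u : A, φ (lam u) = ψ u) ∧
    ∀ u : A, u ≠ Q.root → G.Adj (lam u) (lam (Q.parent u))

/-- Weight of a complete homomorphic match: sum of the edge weights of the images of the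
query edges (each non-root query node contributes its parent edge). -/
def matchWeight [Fintype A] [DecidableEq A] (w : Sym2 V → ℝ) (Q : QueryTree A)
    (lam : A → V) : ℝ :=
  ∑ u ∈ Finset.univ.filter (fun u : A => u ≠ Q.root), w s(lam u, lam (Q.parent u))

/-- The node set of the subtree `Q_u` of `Q` rooted at `u`: all descendants of `u`. -/
def desc (Q : QueryTree A) (u : A) : Set A := {v | ∃ n : ℕ, Q.parent^[n] v = u}

/-- A subtree match at `(u, c)`: a homomorphic match of the subtree `Q_u` in `G`
mapping `u` to `c` (values outside `Q_u` are unconstrained). -/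
def IsSubtreeMatch [Fintype A] [DecidableEq A] (G : SimpleGraph V) (φ : V → L)
    (Q : QueryTree A) (ψ : A → L) (u : A) (c : V) (μ : A → V) : Prop :=
  μ u = c ∧ (∀ v ∈ desc Q u, φ (μ v) = ψ v) ∧
    ∀ v ∈ desc Q u, v ≠ u → G.Adj (μ v) (μ (Q.parent v))

/-- Weight of a subtree match at `u`: sum of `w` over the images of the edges of `Q_u`. -/
def subtreeWeight [Fintype A] [DecidableEq A] (w : Sym2 V → ℝ) (Q : QueryTree A)
    (u : A) (μ : A → V) : ℝ :=
  ∑ v ∈ Finset.univ.filter (fun v : A => v ∈ desc Q u ∧ v ≠ u),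
    w s(μ v, μ (Q.parent v))

/-- There exists a subtree match at `(u, c)`. -/
def SubtreeMatchExists [Fintype A] [DecidableEq A] (G : SimpleGraph V) (φ : V → L)
    (Q : QueryTree A) (ψ : A → L) (u : A) (c : V) : Prop :=
  ∃ μ : A → V, IsSubtreeMatch G φ Q ψ u c μ

/-- Minimum subtree weight `W(u, c)`: the minimum of the weights of all subtree
matches at `(u, c)` (meaningful whenever such a match exists). -/
def minW [Fintype A] [DecidableEq A] (G : SimpleGraph V) (φ : V → L) (w : Sym2 V → ℝ)
    (Q : QueryTree A) (ψ : A → L) (u : A) (c : V) : ℝ :=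
  sInf {x : ℝ | ∃ μ : A → V, IsSubtreeMatch G φ Q ψ u c μ ∧ subtreeWeight w Q u μ = x}

/-- A rooted prefix of `Q`: contains the root and is closed under taking parents. -/
def IsRootedPrefix (Q : QueryTree A) (S : Finset A) : Prop :=
  Q.root ∈ S ∧ ∀ v ∈ S, Q.parent v ∈ S

/-- Boundary `∂S`: the query nodes outside `S` whose parent lies in `S`. -/
def boundary [Fintype A] [DecidableEq A] (Q : QueryTree A) (S : Finset A) : Finset A :=
  Finset.univ.filter (fun u : A => u ∉ S ∧ Q.parent u ∈ S)

/-- A partial match on the rooted prefix `S`: a homomorphic match of the induced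
subtree `Q[S]` in `G` (values outside `S` are unconstrained). -/
def IsPartialMatch [Fintype A] [DecidableEq A] (G : SimpleGraph V) (φ : V → L)
    (Q : QueryTree A) (ψ : A → L) (S : Finset A) (P : A → V) : Prop :=
  (∀ u ∈ S, φ (P u) = ψ u) ∧ ∀ u ∈ S, u ≠ Q.root → G.Adj (P u) (P (Q.parent u))

/-- The set `{ w({c, c'}) + W(u', c') : c' a neighbor of c, φ(c') = ψ(u'),
a subtree match at (u', c') exists }`. -/
def candSet [Fintype A] [DecidableEq A] (G : SimpleGraph V) (φ : V → L) (w : Sym2 V → ℝ)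
    (Q : QueryTree A) (ψ : A → L) (c : V) (u' : A) : Set ℝ :=
  {x : ℝ | ∃ c' : V, G.Adj c c' ∧ φ c' = ψ u' ∧ SubtreeMatchExists G φ Q ψ u' c' ∧
      x = w s(c, c') + minW G φ w Q ψ u' c'}

/-- Priority of a partial match `P` on the rooted prefix `S`. -/
def priorityVal [Fintype A] [DecidableEq A] (G : SimpleGraph V) (φ : V → L)
    (w : Sym2 V → ℝ) (Q : QueryTree A) (ψ : A → L) (S : Finset A) (P : A → V) : ℝ :=
  (∑ u ∈ S.filter (fun u : A => u ≠ Q.root), w s(P u, P (Q.parent u))) +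
    ∑ u' ∈ boundary Q S, sInf (candSet G φ w Q ψ (P (Q.parent u')) u')

theorem QueryTree.eq_root_of_iterate_eq (Q : QueryTree A) {v : A} {n : ℕ} (hn : 0 < n)
    (h : Q.parent^[n] v = v) : v = Q.root := by
  obtain ⟨m, hm⟩ := Q.reaches v
  have hfix : Q.parent^[n * m] v = v := by
    rw [Function.iterate_mul]
    exact Function.iterate_fixed h m
  have hroot : Q.parent^[n * m - m] Q.root = Q.root := Function.iterate_fixed Q.parent_root _
  rw [← hfix, ← hroot, ← hm, ← Function.iterate_add_apply,
    Nat.sub_add_cancel (Nat.le_mul_of_pos_left m hn)]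

theorem mem_desc_self (Q : QueryTree A) (u : A) : u ∈ desc Q u := ⟨0, rfl⟩

theorem mem_desc_of_parent {Q : QueryTree A} {u x : A} (h : Q.parent x ∈ desc Q u) :
    x ∈ desc Q u := by
  obtain ⟨n, hn⟩ := h
  exact ⟨n + 1, by rwa [Function.iterate_succ_apply]⟩

theorem parent_mem_desc {Q : QueryTree A} {u x : A} (h : x ∈ desc Q u) (hx : x ≠ u) :
    Q.parent x ∈ desc Q u := by
  obtain ⟨n, hn⟩ := h
  cases n with
  | zero => exact absurd hn hx
  | succ n => exact ⟨n, by rwa [Function.iterate_succ_apply] at hn⟩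

theorem desc_subset_of_parent {Q : QueryTree A} {u v : A} (hv : Q.parent v = u) :
    desc Q v ⊆ desc Q u := by
  rintro x ⟨n, hn⟩
  exact ⟨n + 1, by rw [Function.iterate_succ_apply', hn, hv]⟩

theorem notMem_desc_of_parent {Q : QueryTree A} {u v : A} (hu : u ≠ Q.root)
    (hv : Q.parent v = u) : u ∉ desc Q v := by
  rintro ⟨n, hn⟩
  exact hu (Q.eq_root_of_iterate_eq n.succ_pos
    (by rw [Function.iterate_succ_apply', hn, hv]))

theorem parent_notMem_desc {Q : QueryTree A} {u : A} (hu : u ≠ Q.root) :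
    Q.parent u ∉ desc Q u := by
  rintro ⟨n, hn⟩
  exact hu (Q.eq_root_of_iterate_eq n.succ_pos (by rwa [Function.iterate_succ_apply]))

theorem notMem_of_mem_desc {Q : QueryTree A} {S : Finset A} (hS : IsRootedPrefix Q S) {u x : A}
    (hu : u ∉ S) (hx : x ∈ desc Q u) : x ∉ S := by
  obtain ⟨n, hn⟩ := hx
  intro hxS
  refine hu (hn ▸ ?_)
  clear hn
  induction n with
  | zero => exact hxS
  | succ n ih => rw [Function.iterate_succ_apply']; exact hS.2 _ ih

theorem desc_disjoint_of_siblings {Q : QueryTree A} {u v v' x : A} (hu : u ≠ Q.root)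
    (hv : Q.parent v = u) (hv' : Q.parent v' = u) (hx : x ∈ desc Q v) (hx' : x ∈ desc Q v') :
    v = v' := by
  obtain ⟨n, hn⟩ := hx
  obtain ⟨m, hm⟩ := hx'
  wlog hnm : n ≤ m generalizing n m v v'
  · exact (this hv' hv m hm n hn (by omega)).symm
  obtain ⟨k, rfl⟩ := Nat.exists_eq_add_of_le hnm
  rw [add_comm, Function.iterate_add_apply, hn] at hm
  cases k with
  | zero => exact hm
  | succ k =>
    rw [Function.iterate_succ_apply, hv] at hm
    exact absurd ⟨k, hm⟩ (notMem_desc_of_parent hu hv')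

theorem exists_parent_eq_of_mem_desc {Q : QueryTree A} {u x : A} (h : x ∈ desc Q u)
    (hx : x ≠ u) : ∃ v, Q.parent v = u ∧ x ∈ desc Q v := by
  obtain ⟨n, hn⟩ := h
  cases n with
  | zero => exact absurd hn hx
  | succ n => exact ⟨_, by rwa [Function.iterate_succ_apply'] at hn, n, rfl⟩

theorem boundary_nonempty [Fintype A] [DecidableEq A] {Q : QueryTree A} {S : Finset A}
    (hS : IsRootedPrefix Q S) (hne : S ≠ Finset.univ) : (boundary Q S).Nonempty := by
  by_contra hempty
  have hclosed : ∀ x, Q.parent x ∈ S → x ∈ S := fun x hx => by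
    by_contra hxS
    exact hempty ⟨x, by simp [boundary, hxS, hx]⟩
  refine hne (Finset.eq_univ_iff_forall.2 fun v => ?_)
  obtain ⟨n, hn⟩ := Q.reaches v
  induction n generalizing v with
  | zero => exact (show v = Q.root from hn) ▸ hS.1
  | succ n ih => exact hclosed v (ih _ (by rwa [Function.iterate_succ_apply] at hn))

theorem sum_desc_eq_sum_children [Fintype A] [DecidableEq A] {Q : QueryTree A} {u : A}
    (hu : u ≠ Q.root) (f : A → ℝ) :
    ∑ x ∈ Finset.univ.filter (fun x : A => x ∈ desc Q u ∧ x ≠ u), f x =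
      ∑ v ∈ Finset.univ.filter (fun v : A => Q.parent v = u),
        (f v + ∑ x ∈ Finset.univ.filter (fun x : A => x ∈ desc Q v ∧ x ≠ v), f x) := by
  have hsplit : ∀ v : A, f v + ∑ x ∈ Finset.univ.filter (fun x : A => x ∈ desc Q v ∧ x ≠ v), f x =
      ∑ x ∈ Finset.univ.filter (fun x : A => x ∈ desc Q v), f x := fun v => by
    rw [← Finset.add_sum_erase _ f (show v ∈ Finset.univ.filter (fun x : A => x ∈ desc Q v) by
      simp [mem_desc_self])]
    congr 2
    ext x
    simp [and_comm]
  simp_rw [hsplit]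
  rw [← Finset.sum_biUnion]
  · refine Finset.sum_congr ?_ fun _ _ => rfl
    ext x
    simp only [Finset.mem_filter, Finset.mem_univ, true_and, Finset.mem_biUnion]
    constructor
    · exact fun h => exists_parent_eq_of_mem_desc h.1 h.2
    · rintro ⟨v, hv, hx⟩
      exact ⟨desc_subset_of_parent hv hx, fun h => notMem_desc_of_parent hu hv (h ▸ hx)⟩
  · intro v hv v' hv' hne
    refine Finset.disjoint_left.2 fun x hx hx' => hne ?_
    simp only [Finset.coe_filter, Finset.mem_filter, Finset.mem_univ, true_and,
      Set.mem_ofPred_eq] at hv hv' hx hx'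
    exact desc_disjoint_of_siblings hu hv hv' hx hx'

theorem IsSubtreeMatch.child [Fintype A] [DecidableEq A] {G : SimpleGraph V} {φ : V → L}
    {Q : QueryTree A} {ψ : A → L} {u v : A} {c : V} {μ : A → V} (hu : u ≠ Q.root)
    (h : IsSubtreeMatch G φ Q ψ u c μ) (hv : Q.parent v = u) :
    IsSubtreeMatch G φ Q ψ v (μ v) μ :=
  ⟨rfl, fun x hx => h.2.1 x (desc_subset_of_parent hv hx), fun x hx _ =>
    h.2.2 x (desc_subset_of_parent hv hx)
      fun hxu => notMem_desc_of_parent hu hv (hxu ▸ hx)⟩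

section MinimumWeights

variable [Fintype V] [Fintype A] [DecidableEq A] (G : SimpleGraph V) (φ : V → L)
  (w : Sym2 V → ℝ) (Q : QueryTree A) (ψ : A → L)

theorem finite_candSet (c : V) (u : A) : (candSet G φ w Q ψ c u).Finite :=
  (Set.finite_range fun c' => w s(c, c') + minW G φ w Q ψ u c').subset
    fun _ ⟨c', _, _, _, h⟩ => ⟨c', h.symm⟩

theorem finite_subtreeWeights (u : A) (c : V) :
    {x : ℝ | ∃ μ : A → V, IsSubtreeMatch G φ Q ψ u c μ ∧ subtreeWeight w Q u μ = x}.Finite :=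
  (Set.finite_range fun μ : A → V => subtreeWeight w Q u μ).subset fun _ ⟨μ, _, h⟩ => ⟨μ, h⟩

variable {G φ Q ψ}

theorem IsSubtreeMatch.minW_le {u : A} {c : V} {μ : A → V} (h : IsSubtreeMatch G φ Q ψ u c μ) :
    minW G φ w Q ψ u c ≤ subtreeWeight w Q u μ :=
  csInf_le (finite_subtreeWeights G φ w Q ψ u c).bddBelow ⟨μ, h, rfl⟩

theorem IsSubtreeMatch.sInf_candSet_le {u v : A} {c : V} {μ : A → V} (hu : u ≠ Q.root)
    (h : IsSubtreeMatch G φ Q ψ u c μ) (hv : Q.parent v = u) :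
    sInf (candSet G φ w Q ψ c v) ≤ w s(μ v, μ (Q.parent v)) + subtreeWeight w Q v μ := by
  have hmem : v ∈ desc Q u := desc_subset_of_parent hv (mem_desc_self Q v)
  have hne : v ≠ u := fun hvu => notMem_desc_of_parent hu hv (hvu ▸ mem_desc_self Q v)
  have hc : μ (Q.parent v) = c := by rw [hv, h.1]
  have hchild := h.child hu hv
  refine (csInf_le (finite_candSet G φ w Q ψ c v).bddBelow
    ⟨μ v, ?_, h.2.1 v hmem, ⟨μ, hchild⟩, rfl⟩).trans ?_
  · exact hc ▸ (h.2.2 v hmem hne).symm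
  · rw [hc, Sym2.eq_swap]
    gcongr
    exact hchild.minW_le w

theorem sum_children_le_minW {u : A} {c : V} (hu : u ≠ Q.root)
    (h : SubtreeMatchExists G φ Q ψ u c) :
    ∑ v ∈ Finset.univ.filter (fun v : A => Q.parent v = u), sInf (candSet G φ w Q ψ c v) ≤
      minW G φ w Q ψ u c := by
  obtain ⟨μ, hμ⟩ := h
  refine le_csInf ⟨_, μ, hμ, rfl⟩ ?_
  rintro _ ⟨ν, hν, rfl⟩
  rw [subtreeWeight, sum_desc_eq_sum_children hu]
  refine Finset.sum_le_sum fun v hv => ?_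
  exact hν.sInf_candSet_le w hu (Finset.mem_filter.1 hv).2

end MinimumWeights

theorem IsMatch.isSubtreeMatch [Fintype A] [DecidableEq A] {G : SimpleGraph V} {φ : V → L}
    {Q : QueryTree A} {ψ : A → L} {lam : A → V} (h : IsMatch G φ Q ψ lam) {u : A}
    (hu : u ≠ Q.root) : IsSubtreeMatch G φ Q ψ u (lam u) lam := by
  refine ⟨rfl, fun v _ => h.1 v, fun v hv hne => h.2 v ?_⟩
  rintro rfl
  obtain ⟨n, hn⟩ := hv
  exact hu (hn ▸ Function.iterate_fixed Q.parent_root n)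

/-- Replacing a match below `u` by a subtree match at `(u, c)` yields a match, provided `c` is
adjacent to the image of the parent of `u`. -/
theorem IsMatch.replace_subtree [Fintype A] [DecidableEq A] {G : SimpleGraph V} {φ : V → L}
    {Q : QueryTree A} {ψ : A → L} {lam μ : A → V} {u : A} {c : V} (h : IsMatch G φ Q ψ lam)
    (hu : u ≠ Q.root) (hμ : IsSubtreeMatch G φ Q ψ u c μ) (hadj : G.Adj (lam (Q.parent u)) c) :
    IsMatch G φ Q ψ (fun x => if x ∈ desc Q u then μ x else lam x) := by
  refine ⟨fun x => ?_, fun x hx => ?_⟩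
  · by_cases hxu : x ∈ desc Q u
    · simp only [hxu, if_true, hμ.2.1 x hxu]
    · simp only [hxu, if_false, h.1 x]
  · by_cases hxu : x ∈ desc Q u
    · rcases eq_or_ne x u with rfl | hne
      · simp only [mem_desc_self, parent_notMem_desc hu, if_true, if_false, hμ.1]
        exact hadj.symm
      · simp only [hxu, parent_mem_desc hxu hne, if_true]
        exact hμ.2.2 x hxu hne
    · have hp : Q.parent x ∉ desc Q u := fun hp => hxu (mem_desc_of_parent hp)
      simp only [hxu, hp, if_false]
      exact h.2 x hx

theorem IsRootedPrefix.insert [Fintype A] [DecidableEq A] {Q : QueryTree A} {S : Finset A}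
    (hS : IsRootedPrefix Q S) {u : A} (hu : u ∈ boundary Q S) :
    IsRootedPrefix Q (Insert.insert u S) := by
  have hup : Q.parent u ∈ S := (Finset.mem_filter.1 hu).2.2
  refine ⟨Finset.mem_insert_of_mem hS.1, fun v hv => Finset.mem_insert_of_mem ?_⟩
  rcases Finset.mem_insert.1 hv with rfl | hv
  exacts [hup, hS.2 v hv]

theorem sum_boundary_insert [Fintype A] [DecidableEq A] {Q : QueryTree A} {S : Finset A}
    (hS : IsRootedPrefix Q S) {u : A} (hu : u ∈ boundary Q S) (f : A → ℝ) :
    ∑ v ∈ boundary Q (insert u S), f v =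
      ∑ v ∈ (boundary Q S).erase u, f v +
        ∑ v ∈ Finset.univ.filter (fun v : A => Q.parent v = u), f v := by
  obtain ⟨huS, hup⟩ := (Finset.mem_filter.1 hu).2
  rw [← Finset.sum_union]
  · refine Finset.sum_congr ?_ fun _ _ => rfl
    ext v
    simp only [boundary, Finset.mem_filter, Finset.mem_univ, true_and, Finset.mem_union,
      Finset.mem_erase, Finset.mem_insert, not_or]
    constructor
    · tauto
    · rintro (⟨h1, h2, h3⟩ | h)
      · exact ⟨⟨h1, h2⟩, Or.inr h3⟩
      · refine ⟨⟨?_, fun hv => huS (h ▸ hS.2 v hv)⟩, Or.inl h⟩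
        rintro rfl
        exact huS (h ▸ hup)
  · refine Finset.disjoint_left.2 fun v hv hv' => huS ?_
    rw [← (Finset.mem_filter.1 hv').2]
    exact (Finset.mem_filter.1 (Finset.mem_of_mem_erase hv)).2.2

/-- Extending a prefix by a boundary node whose image attains the minimum of the candidate set
does not increase the priority. -/
theorem priorityVal_insert_le [Fintype V] [Fintype A] [DecidableEq A] {G : SimpleGraph V}
    {φ : V → L} (w : Sym2 V → ℝ) {Q : QueryTree A} {ψ : A → L} {S : Finset A}
    (hS : IsRootedPrefix Q S) {u : A} (hu : u ∈ boundary Q S) {P P' : A → V}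
    (hagree : ∀ v ∈ S, P' v = P v) (hex : SubtreeMatchExists G φ Q ψ u (P' u))
    (hmin : sInf (candSet G φ w Q ψ (P (Q.parent u)) u) =
      w s(P (Q.parent u), P' u) + minW G φ w Q ψ u (P' u)) :
    priorityVal G φ w Q ψ (insert u S) P' ≤ priorityVal G φ w Q ψ S P := by
  obtain ⟨huS, hup⟩ := (Finset.mem_filter.1 hu).2
  have hur : u ≠ Q.root := fun h => huS (h ▸ hS.1)
  have hedges : ∑ v ∈ S.filter (fun v : A => v ≠ Q.root), w s(P' v, P' (Q.parent v)) =
      ∑ v ∈ S.filter (fun v : A => v ≠ Q.root), w s(P v, P (Q.parent v)) :=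
    Finset.sum_congr rfl fun v hv => by
      have hvS := (Finset.mem_filter.1 hv).1
      rw [hagree v hvS, hagree _ (hS.2 v hvS)]
  have hrest : ∑ v ∈ (boundary Q S).erase u, sInf (candSet G φ w Q ψ (P' (Q.parent v)) v) =
      ∑ v ∈ (boundary Q S).erase u, sInf (candSet G φ w Q ψ (P (Q.parent v)) v) :=
    Finset.sum_congr rfl fun v hv => by
      rw [hagree _ (Finset.mem_filter.1 (Finset.mem_of_mem_erase hv)).2.2]
  have hchildren : ∑ v ∈ Finset.univ.filter (fun v : A => Q.parent v = u),
        sInf (candSet G φ w Q ψ (P' (Q.parent v)) v) ≤ minW G φ w Q ψ u (P' u) := by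
    refine le_of_eq_of_le (Finset.sum_congr rfl fun v hv => ?_) (sum_children_le_minW w hur hex)
    rw [(Finset.mem_filter.1 hv).2]
  rw [priorityVal, priorityVal, Finset.filter_insert, if_pos hur,
    Finset.sum_insert (fun h => huS (Finset.mem_filter.1 h).1), sum_boundary_insert hS hu,
    ← Finset.add_sum_erase _ _ hu, hmin, hedges, hrest, hagree _ hup,
    Sym2.eq_swap (a := P' u)]
  linarith

/-- soundness of the front-element optimization: if `B` is a finite
nonempty collection of partial matches, each having a complete homomorphic match as a
successor, and `P ∈ B` is non-complete with minimum priority over `B`, then `P` has a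
direct successor `P'`, having a complete homomorphic match as a successor, whose
priority is still a minimum over `B`. -/
theorem stmt8 [Fintype V] [DecidableEq V] [Fintype A] [DecidableEq A]
    (G : SimpleGraph V) (φ : V → L) (w : Sym2 V → ℝ) (Q : QueryTree A) (ψ : A → L)
    (B : Finset (Finset A × (A → V))) (hBne : B.Nonempty)
    (hB : ∀ X ∈ B, IsRootedPrefix Q X.1 ∧ IsPartialMatch G φ Q ψ X.1 X.2 ∧
      ∃ lam : A → V, IsMatch G φ Q ψ lam ∧ ∀ u ∈ X.1, lam u = X.2 u)
    (S : Finset A) (P : A → V) (hmem : (S, P) ∈ B) (hnc : S ≠ Finset.univ)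
    (hmin : ∀ X ∈ B, priorityVal G φ w Q ψ S P ≤ priorityVal G φ w Q ψ X.1 X.2) :
    ∃ (S' : Finset A) (P' : A → V),
      IsRootedPrefix Q S' ∧ IsPartialMatch G φ Q ψ S' P' ∧
      S ⊆ S' ∧ S'.card = S.card + 1 ∧ (∀ u ∈ S, P' u = P u) ∧
      (∃ lam : A → V, IsMatch G φ Q ψ lam ∧ ∀ u ∈ S', lam u = P' u) ∧
      ∀ X ∈ B, priorityVal G φ w Q ψ S' P' ≤ priorityVal G φ w Q ψ X.1 X.2 := by
  obtain ⟨hS, -, lam, hlam, hagree⟩ := hB _ hmem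
  obtain ⟨u, hu⟩ := boundary_nonempty hS hnc
  obtain ⟨huS, hup⟩ := (Finset.mem_filter.1 hu).2
  have hur : u ≠ Q.root := fun h => huS (h ▸ hS.1)
  have hadj := (hlam.2 u hur).symm
  rw [hagree _ hup] at hadj
  have hne : (candSet G φ w Q ψ (P (Q.parent u)) u).Nonempty :=
    ⟨_, lam u, hadj, hlam.1 u, ⟨lam, hlam.isSubtreeMatch hur⟩, rfl⟩
  obtain ⟨c, hc, -, hex, hval⟩ := hne.csInf_mem (finite_candSet G φ w Q ψ _ u)
  obtain ⟨μ, hμ⟩ := id hex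
  have hrep := hlam.replace_subtree hur hμ (by rwa [hagree _ hup])
  set P' : A → V := fun x => if x ∈ desc Q u then μ x else lam x with hP'
  have hP'u : P' u = c := by simp only [hP', mem_desc_self, if_true, hμ.1]
  have hP'S : ∀ v ∈ S, P' v = P v := fun v hv => by
    have hvu : v ∉ desc Q u := fun h => notMem_of_mem_desc hS huS h hv
    simp only [hP', hvu, if_false]
    exact hagree v hv
  refine ⟨insert u S, P', hS.insert hu, ⟨fun v _ => hrep.1 v, fun v _ => hrep.2 v⟩,
    Finset.subset_insert u S, Finset.card_insert_of_notMem huS, hP'S,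
    ⟨P', hrep, fun _ _ => rfl⟩, fun X hX => le_trans ?_ (hmin X hX)⟩
  exact priorityVal_insert_le w hS hu hP'S (hP'u.symm ▸ hex) (by rw [hP'u]; exact hval)
end
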